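/- Characterization on the Condorcet domain: an SDR C on the Condorcet domain W* is Condorcet-consistent (i.e., C(R) = CW(R) for every R ∈ W*) if and only if C satisfies weak top consistency (WTC), top symmetry (TS), top monotonicity (TM), top rationality (TR) and Maskin monotonicity (MM), where all axioms are required only for profiles lying in W*. -/

import Mathlib

/-- A weak order on `A`: a complete (total) and transitive binary relation. -/
structure WeakOrd (A : Type*) where
  rel : A → A → Prop
  total : ∀ x y, rel x y ∨ rel y x
  trans : ∀ x y z, rel x y → rel y z → rel x z

namespace WeakOrd

variable {A : Type*}

/-- Strict preference. -/
def strict (r : WeakOrd A) (x y : A) : Prop := r.rel x y ∧ ¬ r.rel y x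

/-- Indifference. -/
def indiff (r : WeakOrd A) (x y : A) : Prop := r.rel x y ∧ r.rel y x

open Classical in
/-- The weak order obtained from `r` by moving `x` and `y` strictly above all other
alternatives, preserving the relative ranking of `x` and `y` and of the rest. -/
noncomputable def topShift (r : WeakOrd A) (x y : A) : WeakOrd A where
  rel a b :=
    if a = x ∨ a = y then (if b = x ∨ b = y then r.rel a b else True)
    else if b = x ∨ b = y then False else r.rel a b
  total := by
    intro a b
    by_cases ha : a = x ∨ a = y <;> by_cases hb : b = x ∨ b = y <;>
      simp [ha, hb, r.total a b]
  trans := by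
    intro a b c hab hbc
    by_cases ha : a = x ∨ a = y <;> by_cases hb : b = x ∨ b = y <;>
      by_cases hc : c = x ∨ c = y <;> simp_all <;>
      exact r.trans _ _ _ hab hbc

/-- Relabelling the alternatives of a weak order by a permutation `σ`:
`a` is weakly preferred to `b` in `σ(r)` iff `σ⁻¹ a` is weakly preferred to `σ⁻¹ b` in `r`. -/
def map (σ : Equiv.Perm A) (r : WeakOrd A) : WeakOrd A where
  rel a b := r.rel (σ.symm a) (σ.symm b)
  total := fun _ _ => r.total _ _
  trans := fun _ _ _ hab hbc => r.trans _ _ _ hab hbc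

end WeakOrd

/-- A (preference) profile: a weak order for each voter. -/
abbrev Profile (N A : Type*) := N → WeakOrd A

namespace Profile

variable {N A : Type*}

/-- The top-shift profile `R^{x,y}`. -/
noncomputable def topShift (R : Profile N A) (x y : A) : Profile N A :=
  fun i => (R i).topShift x y

/-- Relabelling alternatives in every voter's preference by a permutation `σ`. -/
def map (σ : Equiv.Perm A) (R : Profile N A) : Profile N A := fun i => (R i).map σ

end Profile

/-- `nwins R x y` is `n(x,y,R)`, the number of voters strictly preferring `x` to `y`. -/
noncomputable def nwins {N A : Type*} (R : Profile N A) (x y : A) : ℕ :=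
  Nat.card {i // (R i).strict x y}

/-- The set of Condorcet winners of `R`. -/
def CW {N A : Type*} (R : Profile N A) : Set A :=
  {x | ∀ y, y ≠ x → nwins R y x ≤ nwins R x y}

/-- Condorcet consistency of a social decision rule. -/
def CondorcetConsistent {N A : Type*} (C : Profile N A → Set A) : Prop :=
  ∀ R : Profile N A, (CW R).Nonempty → C R = CW R

/-- The nice set `N_C(R)`: alternatives selected each time they are top-shifted with any
other alternative. -/
def niceSet {N A : Type*} (C : Profile N A → Set A) (R : Profile N A) : Set A :=
  {x | ∀ y, y ≠ x → x ∈ C (R.topShift x y)}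

/-- Weak top consistency (WTC). -/
def WeakTopConsistency {N A : Type*} (C : Profile N A → Set A) : Prop :=
  ∀ R : Profile N A, niceSet C R ⊆ C R

/-- Top consistency (TC). -/
def TopConsistency {N A : Type*} (C : Profile N A → Set A) : Prop :=
  ∀ R : Profile N A, (niceSet C R).Nonempty → C R = niceSet C R

/-- A 2-profile: two alternatives are unanimously strictly preferred to all others. -/
def IsTwoProfile {N A : Type*} (R : Profile N A) : Prop :=
  ∃ x y : A, x ≠ y ∧
    ∀ z, z ≠ x → z ≠ y → ∀ i, (R i).strict x z ∧ (R i).strict y z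

/-- Top anonymity (TA). -/
def TopAnonymity {N A : Type*} (C : Profile N A → Set A) : Prop :=
  ∀ R : Profile N A, IsTwoProfile R → ∀ π : Equiv.Perm N, C (fun i => R (π i)) = C R

/-- Top neutrality (TN). -/
def TopNeutrality {N A : Type*} (C : Profile N A → Set A) : Prop :=
  ∀ R : Profile N A, IsTwoProfile R → ∀ σ : Equiv.Perm A, C (Profile.map σ R) = σ '' (C R)

/-- Top symmetry (TS): top anonymity and top neutrality. -/
def TopSymmetry {N A : Type*} (C : Profile N A → Set A) : Prop :=
  TopAnonymity C ∧ TopNeutrality C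

/-- `Improves R Q x z`, i.e. `R ▷^{x,z} Q`: `Q` is an additional support of `x`
against `z` from `R` to `Q`. -/
def Improves {N A : Type*} (R Q : Profile N A) (x z : A) : Prop :=
  (∀ i w, ((R i).strict x w → (Q i).strict x w) ∧ ((R i).indiff x w → (Q i).rel x w)) ∧
  ∃ i, (R i).rel z x ∧ (Q i).strict x z

/-- Top monotonicity (TM). -/
def TopMonotonicity {N A : Type*} (C : Profile N A → Set A) : Prop :=
  ∀ (R Q : Profile N A) (x y z : A), x ≠ y → z ≠ x →
    x ∈ C (R.topShift x y) → Improves R Q x z →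
    x ∈ C (Q.topShift x y) ∧ z ∉ C (Q.topShift x y)

/-- Top rationality (TR). -/
def TopRationality {N A : Type*} (C : Profile N A → Set A) : Prop :=
  ∀ (R : Profile N A) (x y : A), x ≠ y → (C (R.topShift x y) ∩ {x, y}).Nonempty

/-- Maskin monotonicity (MM). -/
def MaskinMonotonic {N A : Type*} (C : Profile N A → Set A) : Prop :=
  ∀ (R Q : Profile N A) (x : A), x ∈ C R →
    (∀ i y, ((R i).strict x y → (Q i).strict x y) ∧ ((R i).indiff x y → (Q i).rel x y)) →
    x ∈ C Q

namespace WeakOrd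

variable {A : Type*}

theorem refl (r : WeakOrd A) (x : A) : r.rel x x := (r.total x x).elim id id

theorem strict_irrefl (r : WeakOrd A) (x : A) : ¬ r.strict x x := fun h => h.2 h.1

theorem strict_iff_not_rel (r : WeakOrd A) (x y : A) : r.strict x y ↔ ¬ r.rel y x :=
  ⟨fun h => h.2, fun h => ⟨(r.total x y).resolve_right h, h⟩⟩

theorem topShift_rel_of_mem (r : WeakOrd A) {x y a b : A} (ha : a = x ∨ a = y)
    (hb : b = x ∨ b = y) : (r.topShift x y).rel a b ↔ r.rel a b := by
  simp [topShift, ha, hb]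

theorem topShift_strict_of_mem (r : WeakOrd A) {x y a b : A} (ha : a = x ∨ a = y)
    (hb : b = x ∨ b = y) : (r.topShift x y).strict a b ↔ r.strict a b := by
  simp [strict, topShift_rel_of_mem, ha, hb]

theorem topShift_strict_of_not_mem (r : WeakOrd A) {x y a b : A} (ha : a = x ∨ a = y)
    (hb : ¬ (b = x ∨ b = y)) : (r.topShift x y).strict a b := by
  simp only [strict, topShift, if_pos ha, if_neg hb, not_false_eq_true, and_self]

end WeakOrd

/-- The alternative `x` does not lose any support when passing from `R` to `Q`. -/
def PreservesSupport {N A : Type*} (R Q : Profile N A) (x : A) : Prop :=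
  ∀ i y, ((R i).strict x y → (Q i).strict x y) ∧ ((R i).indiff x y → (Q i).rel x y)

section Condorcet

variable {N A : Type*}

theorem preservesSupport_topShift (R : Profile N A) {x y a : A} (ha : a = x ∨ a = y) :
    PreservesSupport R (R.topShift x y) a := by
  intro i w
  by_cases hw : w = x ∨ w = y
  · exact ⟨((R i).topShift_strict_of_mem ha hw).2, fun h => ((R i).topShift_rel_of_mem ha hw).2 h.1⟩
  · have h := (R i).topShift_strict_of_not_mem ha hw
    exact ⟨fun _ => h, fun _ => h.1⟩

theorem PreservesSupport.strict_of_strict {R Q : Profile N A} {x y : A}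
    (h : PreservesSupport R Q x) {i : N} (hi : (Q i).strict y x) : (R i).strict y x := by
  rw [WeakOrd.strict_iff_not_rel]
  intro hxy
  by_cases hyx : (R i).rel y x
  · exact hi.2 ((h i y).2 ⟨hxy, hyx⟩)
  · exact hi.2 ((h i y).1 ⟨hxy, hyx⟩).1

theorem nwins_le_nwins [Finite N] {R Q : Profile N A} {a b c d : A}
    (h : ∀ i, (R i).strict a b → (Q i).strict c d) : nwins R a b ≤ nwins Q c d :=
  Nat.card_mono (s := {i | (R i).strict a b}) (Set.toFinite _) h

theorem nwins_lt_nwins [Finite N] {R Q : Profile N A} {a b c d : A}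
    (h : ∀ i, (R i).strict a b → (Q i).strict c d)
    (hi : ∃ i, (Q i).strict c d ∧ ¬ (R i).strict a b) : nwins R a b < nwins Q c d := by
  obtain ⟨i, hQ, hR⟩ := hi
  exact Set.ncard_lt_ncard (s := {i | (R i).strict a b}) (t := {i | (Q i).strict c d})
    ⟨h, fun hh => hR (hh hQ)⟩

theorem PreservesSupport.mem_CW [Finite N] {R Q : Profile N A} {x : A}
    (h : PreservesSupport R Q x) (hx : x ∈ CW R) : x ∈ CW Q := fun y hy =>
  (nwins_le_nwins fun _ => h.strict_of_strict).trans
    ((hx y hy).trans (nwins_le_nwins fun i => (h i y).1))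

theorem nwins_topShift (R : Profile N A) {x y a b : A} (ha : a = x ∨ a = y)
    (hb : b = x ∨ b = y) : nwins (R.topShift x y) a b = nwins R a b :=
  Nat.card_congr (Equiv.subtypeEquivRight fun i => (R i).topShift_strict_of_mem ha hb)

theorem IsTwoProfile.CW_nonempty [Finite N] {R : Profile N A} (h : IsTwoProfile R) :
    (CW R).Nonempty := by
  obtain ⟨x, y, -, h⟩ := h
  rcases le_total (nwins R y x) (nwins R x y) with hle | hle
  · refine ⟨x, fun z hz => ?_⟩
    by_cases hzy : z = y
    · exact hzy ▸ hle
    · exact nwins_le_nwins fun i hi => absurd (h z hz hzy i).1.1 hi.2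
  · refine ⟨y, fun z hz => ?_⟩
    by_cases hzx : z = x
    · exact hzx ▸ hle
    · exact nwins_le_nwins fun i hi => absurd (h z hzx hz i).2.1 hi.2

theorem isTwoProfile_topShift (R : Profile N A) {x y : A} (hxy : x ≠ y) :
    IsTwoProfile (R.topShift x y) :=
  ⟨x, y, hxy, fun _ hzx hzy i =>
    ⟨(R i).topShift_strict_of_not_mem (.inl rfl) (not_or.2 ⟨hzx, hzy⟩),
      (R i).topShift_strict_of_not_mem (.inr rfl) (not_or.2 ⟨hzx, hzy⟩)⟩⟩

theorem mem_CW_topShift_left [Finite N] {R : Profile N A} {x y : A} (hxy : x ≠ y) :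
    x ∈ CW (R.topShift x y) ↔ nwins R y x ≤ nwins R x y := by
  have hx := nwins_topShift R (.inl rfl : x = x ∨ x = y) (.inr rfl : y = x ∨ y = y)
  have hy := nwins_topShift R (.inr rfl : y = x ∨ y = y) (.inl rfl : x = x ∨ x = y)
  refine ⟨fun h => hx ▸ hy ▸ h y hxy.symm, fun h z hz => ?_⟩
  by_cases hzy : z = y
  · rw [hzy, hx, hy]
    exact h
  · exact nwins_le_nwins fun i hi => absurd
      ((R i).topShift_strict_of_not_mem (.inl rfl) (not_or.2 ⟨hz, hzy⟩)).1 hi.2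

theorem IsTwoProfile.comp_perm {R : Profile N A} (h : IsTwoProfile R) (π : Equiv.Perm N) :
    IsTwoProfile fun i => R (π i) := by
  obtain ⟨x, y, hxy, h⟩ := h
  exact ⟨x, y, hxy, fun z hzx hzy i => h z hzx hzy (π i)⟩

theorem IsTwoProfile.map {R : Profile N A} (h : IsTwoProfile R) (σ : Equiv.Perm A) :
    IsTwoProfile (Profile.map σ R) := by
  obtain ⟨x, y, hxy, h⟩ := h
  refine ⟨σ x, σ y, σ.injective.ne hxy, fun z hzx hzy i => ?_⟩
  have := h (σ.symm z) (fun e => hzx (by simp [← e])) (fun e => hzy (by simp [← e])) i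
  simpa [Profile.map, WeakOrd.map, WeakOrd.strict] using this

theorem CW_comp_perm (R : Profile N A) (π : Equiv.Perm N) :
    CW (fun i => R (π i)) = CW R := by
  have h (a b : A) : nwins (fun i => R (π i)) a b = nwins R a b :=
    Nat.card_congr (π.subtypeEquiv fun _ => Iff.rfl)
  simp [CW, h]

theorem CW_map (R : Profile N A) (σ : Equiv.Perm A) : CW (Profile.map σ R) = σ '' CW R := by
  ext x
  rw [Equiv.image_eq_preimage_symm]
  have h (a b : A) : nwins (Profile.map σ R) a b = nwins R (σ.symm a) (σ.symm b) := rfl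
  simp only [CW, Set.mem_ofPred_eq, Set.mem_preimage, h]
  refine ⟨fun hx y hy => ?_, fun hx y hy => hx _ (σ.symm.injective.ne hy)⟩
  simpa using hx (σ y) (fun e => hy (by simp [← e]))

/-- If `M` and `P` are disjoint and `M` has at most as many elements as `P`, some permutation
sends `M` into `P` and keeps every element outside `M ∪ P` outside `M`. -/
theorem exists_perm_of_card_le [Finite N] {M P : N → Prop} (hd : ∀ i, M i → ¬ P i)
    (hle : Nat.card {i // M i} ≤ Nat.card {i // P i}) :
    ∃ τ : Equiv.Perm N, (∀ i, M i → P (τ i)) ∧ ∀ i, ¬ M i → ¬ P i → ¬ M (τ i) := by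
  classical
  cases nonempty_fintype N
  simp only [Nat.card_eq_fintype_card] at hle
  obtain ⟨e⟩ := Function.Embedding.nonempty_of_card_le hle
  let f : N → N := fun i => if h : M i then e ⟨i, h⟩ else i
  have hM (i : N) (h : M i) : f i = e ⟨i, h⟩ := dif_pos h
  have hI (i : N) (h : ¬ M i) : f i = i := dif_neg h
  have hinj : Set.InjOn f (Finset.univ.filter fun i => ¬ P i) := by
    intro i hi j hj hij
    simp only [Finset.coe_filter, Finset.mem_univ, true_and, Set.mem_ofPred_eq] at hi hj
    by_cases hMi : M i <;> by_cases hMj : M j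
    · rw [hM i hMi, hM j hMj] at hij
      simpa using e.injective (Subtype.ext hij)
    · rw [hM i hMi, hI j hMj] at hij
      exact absurd (hij ▸ (e ⟨i, hMi⟩).2) hj
    · rw [hI i hMi, hM j hMj] at hij
      exact absurd (hij ▸ (e ⟨j, hMj⟩).2) hi
    · rwa [hI i hMi, hI j hMj] at hij
  obtain ⟨g, hg⟩ := Finset.exists_equiv_extend_of_card_eq (t := Finset.univ)
    Finset.card_univ.symm (Finset.subset_univ _) hinj
  refine ⟨g.trans (Equiv.subtypeUnivEquiv Finset.mem_univ), fun i hi => ?_, fun i hi hP => ?_⟩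
  · have := hg i (by simpa using hd i hi)
    rw [hM i hi] at this
    simpa [this] using (e ⟨i, hi⟩).2
  · have := hg i (by simpa using hP)
    rw [hI i hi] at this
    simpa [this] using hi

variable {C : Profile N A → Set A}

/-- If `y` is chosen in `R^{x,y}` although it does not beat `x`, then exchanging the names of `x`
and `y` and permuting voters yields a profile selecting `x` from which `x` gains support on the
way to `R^{x,y}`, strictly against `y` when `x` beats `y`. -/
theorem exists_preservesSupport_topShift [Finite N] (hTS : TopSymmetry C) {R : Profile N A}
    {x y : A} (hxy : x ≠ y) (hle : nwins R y x ≤ nwins R x y) (hy : y ∈ C (R.topShift x y)) :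
    ∃ S : Profile N A, IsTwoProfile S ∧ x ∈ C S ∧ PreservesSupport S (R.topShift x y) x ∧
      (nwins R y x < nwins R x y → ∃ i, (S i).rel y x ∧ ((R.topShift x y) i).strict x y) := by
  classical
  obtain ⟨τ, hMP, hI⟩ := exists_perm_of_card_le (M := fun i => (R i).strict y x)
    (P := fun i => (R i).strict x y) (fun i h h' => h.2 h'.1) hle
  set T := R.topShift x y with hT
  have h2 : IsTwoProfile T := isTwoProfile_topShift R hxy
  have hTs (i : N) : (T i).strict x y ↔ (R i).strict x y :=
    (R i).topShift_strict_of_mem (.inl rfl) (.inr rfl)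
  have hTr (i : N) : (T i).rel x y ↔ (R i).rel x y :=
    (R i).topShift_rel_of_mem (.inl rfl) (.inr rfl)
  have hTr' (i : N) : (T i).rel y x ↔ (R i).rel y x :=
    (R i).topShift_rel_of_mem (.inr rfl) (.inl rfl)
  have hSr (i : N) : ((T i).map (Equiv.swap x y)).rel x y ↔ (R i).rel y x := by
    simp [WeakOrd.map, hTr']
  have hSr' (i : N) : ((T i).map (Equiv.swap x y)).rel y x ↔ (R i).rel x y := by
    simp [WeakOrd.map, hTr]
  refine ⟨fun i => Profile.map (Equiv.swap x y) T (τ.symm i), (h2.map _).comp_perm _, ?_, ?_, ?_⟩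
  · rw [hTS.1 _ (h2.map _), hTS.2 _ h2]
    exact ⟨y, hy, Equiv.swap_apply_right x y⟩
  · intro i w
    by_cases hwx : w = x
    · subst hwx
      exact ⟨fun h => absurd h (WeakOrd.strict_irrefl _ _), fun _ => WeakOrd.refl _ _⟩
    by_cases hwy : w = y
    · subst hwy
      have hM := hMP (τ.symm i)
      have hN := hI (τ.symm i)
      simp only [Equiv.apply_symm_apply, WeakOrd.strict] at hM hN
      have ht := (R i).total x w
      simp only [Profile.map, WeakOrd.strict, WeakOrd.indiff, hSr, hSr', hTr, hTr']
      tauto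
    · have h := (R i).topShift_strict_of_not_mem (b := w) (.inl rfl) (not_or.2 ⟨hwx, hwy⟩)
      exact ⟨fun _ => h, fun _ => h.1⟩
  · intro hlt
    by_contra! hcon
    refine hlt.not_ge ?_
    have hsub (i : N) (hi : (R i).strict x y) : (R (τ.symm i)).strict y x := by
      rw [WeakOrd.strict_iff_not_rel, ← hSr']
      exact fun h => hcon i h ((hTs i).2 hi)
    exact Nat.card_le_card_of_injective
      (fun i : {i // (R i).strict x y} => (⟨τ.symm i, hsub i i.2⟩ : {i // (R i).strict y x}))
      fun i j hij => Subtype.ext (by simpa using hij)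

theorem mem_topShift_of_nwins_le [Finite N] (hTS : TopSymmetry C) (hTR : TopRationality C)
    (hMM : ∀ R Q : Profile N A, (CW R).Nonempty → (CW Q).Nonempty →
      ∀ x : A, x ∈ C R → PreservesSupport R Q x → x ∈ C Q)
    {R : Profile N A} {x y : A} (hxy : x ≠ y) (hle : nwins R y x ≤ nwins R x y) :
    x ∈ C (R.topShift x y) := by
  obtain ⟨z, hz, rfl | rfl⟩ := hTR R x y hxy
  · exact hz
  · obtain ⟨S, h2, hS, hST, -⟩ := exists_preservesSupport_topShift hTS hxy hle hz
    exact hMM S _ h2.CW_nonempty (isTwoProfile_topShift R hxy).CW_nonempty x hS hST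

theorem not_mem_topShift_of_nwins_lt [Finite N] (hTS : TopSymmetry C) (hTM : TopMonotonicity C)
    (hMM : ∀ R Q : Profile N A, (CW R).Nonempty → (CW Q).Nonempty →
      ∀ x : A, x ∈ C R → PreservesSupport R Q x → x ∈ C Q)
    {R : Profile N A} {x y : A} (hxy : x ≠ y) (hlt : nwins R y x < nwins R x y) :
    y ∉ C (R.topShift x y) := by
  intro hy
  obtain ⟨S, h2, hS, hST, hi⟩ := exists_preservesSupport_topShift hTS hxy hlt.le hy
  have hne (Q : Profile N A) : (CW (Q.topShift x y)).Nonempty :=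
    (isTwoProfile_topShift Q hxy).CW_nonempty
  have hS' := hMM S _ h2.CW_nonempty (hne S) x hS (preservesSupport_topShift S (.inl rfl))
  exact (hTM S (R.topShift x y) x y y hxy hxy.symm hS' ⟨hST, hi hlt⟩).2
    (hMM _ _ (hne R) (hne _) y hy (preservesSupport_topShift _ (.inr rfl)))

end Condorcet

/-- **Characterization on the Condorcet domain.** An SDR on the
Condorcet domain `W*` (profiles admitting a Condorcet winner) is
Condorcet-consistent iff it satisfies WTC, TS, TM, TR and Maskin monotonicity,
all axioms being required only on `W*` (note that every top-shift profile and
every 2-profile lies in `W*`). -/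
theorem stmt_16 {N A : Type*} [Fintype N] [Fintype A]
    (hN : 2 ≤ Fintype.card N) (hA : 3 ≤ Fintype.card A)
    (C : Profile N A → Set A)
    (hCne : ∀ R : Profile N A, (CW R).Nonempty → (C R).Nonempty) :
    (∀ R : Profile N A, (CW R).Nonempty → C R = CW R) ↔
      ((∀ R : Profile N A, (CW R).Nonempty → niceSet C R ⊆ C R) ∧
        TopSymmetry C ∧ TopMonotonicity C ∧ TopRationality C ∧
        (∀ R Q : Profile N A, (CW R).Nonempty → (CW Q).Nonempty →
          ∀ x : A, x ∈ C R →
            (∀ (i : N) (y : A), ((R i).strict x y → (Q i).strict x y) ∧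
              ((R i).indiff x y → (Q i).rel x y)) →
            x ∈ C Q)) := by
  have hne (R : Profile N A) {x y : A} (hxy : x ≠ y) : (CW (R.topShift x y)).Nonempty :=
    (isTwoProfile_topShift R hxy).CW_nonempty
  constructor
  · intro h
    refine ⟨fun R hR x hx => ?_, ⟨fun R hR π => ?_, fun R hR σ => ?_⟩, ?_, ?_, ?_⟩
    · rw [h R hR]
      intro y hy
      have := hx y hy
      rwa [h _ (hne R hy.symm), mem_CW_topShift_left hy.symm] at this
    · rw [h _ (hR.comp_perm π).CW_nonempty, h R hR.CW_nonempty, CW_comp_perm]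
    · rw [h _ (hR.map σ).CW_nonempty, h R hR.CW_nonempty, CW_map]
    · intro R Q x y z hxy hzx hx ⟨hRQ, i, hiR, hiQ⟩
      have hRQ : PreservesSupport R Q x := hRQ
      rw [h _ (hne R hxy), mem_CW_topShift_left hxy] at hx
      rw [h _ (hne Q hxy), mem_CW_topShift_left hxy]
      have hback : nwins Q y x ≤ nwins R y x := nwins_le_nwins fun _ => hRQ.strict_of_strict
      refine ⟨hback.trans (hx.trans (nwins_le_nwins fun j => (hRQ j y).1)), fun hz => ?_⟩
      have hz := hz x hzx.symm
      by_cases hzy : z = y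
      · subst hzy
        rw [nwins_topShift Q (.inl rfl) (.inr rfl), nwins_topShift Q (.inr rfl) (.inl rfl)] at hz
        have hlt : nwins R x z < nwins Q x z :=
          nwins_lt_nwins (fun j => (hRQ j z).1) ⟨i, hiQ, fun hs => hs.2 hiR⟩
        omega
      · have htop (j : N) : ((Q.topShift x y) j).strict x z :=
          (Q j).topShift_strict_of_not_mem (.inl rfl) (not_or.2 ⟨hzx, hzy⟩)
        exact hz.not_gt (nwins_lt_nwins (fun j _ => htop j) ⟨i, htop i, fun hs => hs.2 (htop i).1⟩)
    · intro R x y hxy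
      rw [h _ (hne R hxy)]
      obtain ⟨z, hz⟩ := hne R hxy
      by_cases hmem : z = x ∨ z = y
      · exact ⟨z, hz, hmem⟩
      · have : Nonempty N := Fintype.card_pos_iff.1 (by omega)
        have htop (j : N) : ((R.topShift x y) j).strict x z :=
          (R j).topShift_strict_of_not_mem (.inl rfl) hmem
        obtain ⟨i⟩ := this
        exact absurd (nwins_lt_nwins (fun j _ => htop j) ⟨i, htop i, fun hs => hs.2 (htop i).1⟩)
          (hz x fun e => hmem (.inl e.symm)).not_gt
    · intro R Q hR hQ x hx hRQ
      rw [h R hR] at hx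
      rw [h Q hQ]
      exact PreservesSupport.mem_CW hRQ hx
  · rintro ⟨hWTC, hTS, hTM, hTR, hMM⟩ R hR
    refine Set.Subset.antisymm (fun y hy x hxy => ?_) fun x hx => hWTC R hR fun y hyx => ?_
    · by_contra! hlt
      exact not_mem_topShift_of_nwins_lt hTS hTM hMM hxy hlt
        (hMM R _ hR (hne R hxy) y hy (preservesSupport_topShift R (.inr rfl)))
    · exact mem_topShift_of_nwins_le hTS hTR hMM hyx.symm (hx y hyx)
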